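/- arXiv:math/0603316 — 2 statements merged into one kernel-verified Lean document; each statement's English description precedes it below -/
import Mathlib

section
/- Fix T > 0, c > 0, a continuous function h : [0,T] → (0,∞), and a utility function u with I the inverse of u′. Let U₁(t,x) = h(t)·u(x/h(t)) and U₂(x) = c·u(x/c) for x ∈ (0,∞). Then, with I₁, I₂, 𝒳, 𝒳⁻¹ as associated to (U₁,U₂), for all t ∈ [0,T] and all x ∈ (0,∞) one has I₁(t, 𝒳⁻¹(t,x)) = α_t^I·x, where α_t^I = h(t) / (c + ∫_t^T h(t′) dt′). -/
open Set Filter MeasureTheory intervalIntegral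

/-- A utility function: `u : (0,∞) → ℝ` strictly increasing, strictly concave,
continuously differentiable with derivative `u'`, satisfying the Inada conditions
`u'(x) → 0` as `x → ∞` and `u'(x) → ∞` as `x → 0⁺`. -/
def IsUtility (u u' : ℝ → ℝ) : Prop :=
  StrictMonoOn u (Set.Ioi 0) ∧ StrictConcaveOn ℝ (Set.Ioi 0) u ∧
  (∀ x ∈ Set.Ioi (0:ℝ), HasDerivAt u (u' x) x) ∧
  ContinuousOn u' (Set.Ioi 0) ∧
  Filter.Tendsto u' Filter.atTop (nhds 0) ∧
  Filter.Tendsto u' (nhdsWithin 0 (Set.Ioi 0)) Filter.atTop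

/-- If the scaled utility `x ↦ a u(x/a)` has derivative `y` at `z > 0`, then `z = a I(y)`,
where `I` is a left inverse of `u'` on `(0,∞)`. -/
theorem eq_mul_of_hasDerivAt_scaled {u u' I : ℝ → ℝ}
    (hu : ∀ x ∈ Set.Ioi (0:ℝ), HasDerivAt u (u' x) x)
    (hI : ∀ x ∈ Set.Ioi (0:ℝ), I (u' x) = x) {a y z : ℝ} (ha : 0 < a) (hz : 0 < z)
    (hd : HasDerivAt (fun x : ℝ => a * u (x / a)) y z) : z = a * I y := by
  have hza : z / a ∈ Set.Ioi (0:ℝ) := div_pos hz ha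
  have hd' : HasDerivAt (fun x : ℝ => a * u (x / a)) (a * (u' (z / a) * (1 / a))) z :=
    ((hu _ hza).comp z ((hasDerivAt_id z).div_const a)).const_mul a
  have hy : y = u' (z / a) := by
    rw [hd.unique hd']
    field_simp
  rw [hy, hI _ hza]
  field_simp

/-- For the separable utilities `U₁(t,x) = h(t) u(x/h(t))` and `U₂(x) = c u(x/c)`, where
`u` is a utility function with `I` the inverse of `u'`, with `I₁, I₂` the inverses of the
marginal utilities, `𝒳(t,y) = I₂ y + ∫_t^T I₁ t' y dt'` and `𝒳⁻¹(t,·)` its inverse in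
`y`, one has `I₁(t, 𝒳⁻¹(t,x)) = αᵗᴵ · x` where `αᵗᴵ = h(t) / (c + ∫_t^T h)`. -/
theorem separable_utility_consumption_fraction (T c : ℝ) (hT : 0 < T) (hc : 0 < c)
    (h : ℝ → ℝ)
    (hh_cont : ContinuousOn h (Set.Icc 0 T))
    (hh_pos : ∀ t ∈ Set.Icc (0:ℝ) T, 0 < h t)
    (u u' I : ℝ → ℝ) (hu : IsUtility u u')
    (hI : ∀ y ∈ Set.Ioi (0:ℝ), 0 < I y ∧ u' (I y) = y)
    (hI' : ∀ x ∈ Set.Ioi (0:ℝ), I (u' x) = x)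
    (I₁ : ℝ → ℝ → ℝ) (I₂ : ℝ → ℝ)
    (hI₁ : ∀ t ∈ Set.Icc (0:ℝ) T, ∀ y ∈ Set.Ioi (0:ℝ),
      0 < I₁ t y ∧ HasDerivAt (fun x : ℝ => h t * u (x / h t)) y (I₁ t y))
    (hI₂ : ∀ y ∈ Set.Ioi (0:ℝ),
      0 < I₂ y ∧ HasDerivAt (fun x : ℝ => c * u (x / c)) y (I₂ y))
    (X Xinv : ℝ → ℝ → ℝ)
    (hX : ∀ t y, X t y = I₂ y + ∫ t' in t..T, I₁ t' y)
    (hXinv : ∀ t ∈ Set.Icc (0:ℝ) T, ∀ x ∈ Set.Ioi (0:ℝ),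
      0 < Xinv t x ∧ X t (Xinv t x) = x) :
    ∀ t ∈ Set.Icc (0:ℝ) T, ∀ x ∈ Set.Ioi (0:ℝ),
      I₁ t (Xinv t x) = (h t / (c + ∫ t' in t..T, h t')) * x := by
  have hI₁_eq : ∀ t ∈ Set.Icc (0:ℝ) T, ∀ y ∈ Set.Ioi (0:ℝ), I₁ t y = h t * I y :=
    fun t ht y hy => eq_mul_of_hasDerivAt_scaled hu.2.2.1 hI' (hh_pos t ht)
      (hI₁ t ht y hy).1 (hI₁ t ht y hy).2
  intro t ht x hx
  obtain ⟨hy, hXy⟩ := hXinv t ht x hx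
  set y := Xinv t x
  have hI₂_eq : I₂ y = c * I y :=
    eq_mul_of_hasDerivAt_scaled hu.2.2.1 hI' hc (hI₂ y hy).1 (hI₂ y hy).2
  have hsub : ∀ s ∈ Set.Icc t T, s ∈ Set.Icc (0:ℝ) T := fun s hs => ⟨ht.1.trans hs.1, hs.2⟩
  have hint : ∫ s in t..T, I₁ s y = (∫ s in t..T, h s) * I y := by
    rw [← intervalIntegral.integral_mul_const]
    refine intervalIntegral.integral_congr fun s hs => ?_
    rw [Set.uIcc_of_le ht.2] at hs
    exact hI₁_eq s (hsub s hs) y hy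
  have hnonneg : 0 ≤ ∫ s in t..T, h s :=
    intervalIntegral.integral_nonneg ht.2 fun s hs => (hh_pos s (hsub s hs)).le
  have hden : c + ∫ s in t..T, h s ≠ 0 := by positivity
  rw [hX, hI₂_eq, hint] at hXy
  rw [hI₁_eq t ht y hy, ← hXy]
  field_simp
end

section
/- Fix T > 0 and a state preference structure (U₁, U₂) with associated I₁, I₂, 𝒳(t,y) = I₂(y) + ∫_t^T I₁(t′,y) dt′ (I₁ jointly continuous), and define G(s,y) = ∫_s^T U₁(t, I₁(t,y)) dt + U₂(I₂(y)). Fix y ∈ (0,∞) and s ∈ [0,T]. Let (Ω, ℱ, P) be a probability space, let ξ : Ω → (0,∞) be a random variable, and let C : [s,T] × Ω → (0,∞) be jointly measurable, such that: E[ξ + ∫_s^T C(t,·) dt] ≤ 𝒳(s,y), the function (t,ω) ↦ U₁(t, C(t,ω)) has integrable negative part with respect to dt ⊗ dP, and U₂(ξ) has integrable negative part. Then E[∫_s^T U₁(t, C(t,·)) dt + U₂(ξ)] ≤ G(s,y). Moreover, equality holds for the deterministic choice C(t,ω) = I₁(t,y) and ξ = I₂(y), whose budget satisfies E[ξ + ∫_s^T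 C(t,·) dt] = 𝒳(s,y). -/
open Set Filter MeasureTheory intervalIntegral

/-- A concave function lies below its tangent lines. -/
lemma ConcaveOn.le_tangent {S : Set ℝ} {f : ℝ → ℝ} (hf : ConcaveOn ℝ S f) {a x d : ℝ}
    (ha : a ∈ S) (hx : x ∈ S) (hd : HasDerivAt f d a) : f x ≤ f a + d * (x - a) := by
  rcases lt_trichotomy x a with h | rfl | h
  · have := hf.le_slope_of_hasDerivAt hx ha h hd
    rw [slope_def_field, le_div_iff₀ (sub_pos.2 h)] at this
    linarith
  · simp
  · have := hf.slope_le_of_hasDerivAt ha hx h hd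
    rw [slope_def_field, div_le_iff₀ (sub_pos.2 h)] at this
    linarith

/-- A function with integrable negative part and an integrable upper bound is integrable. -/
lemma MeasureTheory.integrable_of_negPart_of_le {α : Type*} [MeasurableSpace α] {μ : Measure α}
    {f g : α → ℝ} (hf : AEStronglyMeasurable f μ) (hneg : Integrable (fun x => max (-f x) 0) μ)
    (hg : Integrable g μ) (hfg : ∀ᵐ x ∂μ, f x ≤ g x) : Integrable f μ := by
  refine (hg.norm.add hneg).mono' hf ?_
  filter_upwards [hfg] with x hx
  have h₁ := le_abs_self (g x)
  have h₂ := le_max_left (-f x) 0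
  have h₃ := le_max_right (-f x) 0
  simp only [Pi.add_apply, Real.norm_eq_abs]
  exact abs_le.2 ⟨by linarith [abs_nonneg (g x)], by linarith⟩

/-- Composing a function continuous on a measurable set with an a.e.-measurable function that
almost surely takes values in that set gives an a.e.-strongly measurable function. -/
lemma ContinuousOn.aestronglyMeasurable_comp {α β : Type*} [MeasurableSpace α] {μ : Measure α}
    [TopologicalSpace β] [MeasurableSpace β] [OpensMeasurableSpace β] {S : Set β} {f : β → ℝ}
    {g : α → β} (hf : ContinuousOn f S) (hS : MeasurableSet S) (hg : AEMeasurable g μ)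
    (hgS : ∀ᵐ x ∂μ, g x ∈ S) : AEStronglyMeasurable (fun x => f (g x)) μ := by
  classical
  have hm : Measurable (S.piecewise f 0) := hf.measurable_piecewise continuousOn_const hS
  refine (hm.comp_aemeasurable hg).aestronglyMeasurable.congr ?_
  filter_upwards [hgS] with x hx
  exact Set.piecewise_eq_of_mem _ _ _ hx

/-- The probabilistic core of the main verification theorem: for a state preference
structure `(U₁, U₂)` with inverse marginal utilities `I₁, I₂`,
`𝒳(t,y) = I₂ y + ∫_t^T I₁ t' y dt'` and `G(s,y) = ∫_s^T U₁(t, I₁(t,y)) dt + U₂(I₂ y)`,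
among all (discounted) consumption rates `C` and terminal wealths `ξ` satisfying the
budget constraint `E[ξ + ∫_s^T C dt] ≤ 𝒳(s,y)` (with the stated measurability and
integrable-negative-part conditions), expected utility is at most `G(s,y)`; equality
holds for the deterministic choice `C(t,ω) = I₁(t,y)`, `ξ = I₂ y`, whose budget equals
`𝒳(s,y)`. -/
theorem expected_utility_verification (T : ℝ) (hT : 0 < T)
    (U₁ U₁' I₁ : ℝ → ℝ → ℝ) (U₂ U₂' I₂ : ℝ → ℝ)
    (hU₁_cont : ContinuousOn (fun p : ℝ × ℝ => U₁ p.1 p.2) (Set.Icc 0 T ×ˢ Set.Ioi 0))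
    (hU₁_mono : ∀ t ∈ Set.Icc (0:ℝ) T, StrictMonoOn (U₁ t) (Set.Ioi 0))
    (hU₁_conc : ∀ t ∈ Set.Icc (0:ℝ) T, StrictConcaveOn ℝ (Set.Ioi 0) (U₁ t))
    (hU₁_deriv : ∀ t ∈ Set.Icc (0:ℝ) T, ∀ x ∈ Set.Ioi (0:ℝ),
      HasDerivAt (U₁ t) (U₁' t x) x)
    (hU₁'_cont : ∀ t ∈ Set.Icc (0:ℝ) T, ContinuousOn (U₁' t) (Set.Ioi 0))
    (hU₁'_top : ∀ t ∈ Set.Icc (0:ℝ) T, Filter.Tendsto (U₁' t) Filter.atTop (nhds 0))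
    (hU₁'_zero : ∀ t ∈ Set.Icc (0:ℝ) T,
      Filter.Tendsto (U₁' t) (nhdsWithin 0 (Set.Ioi 0)) Filter.atTop)
    (hU₂_mono : StrictMonoOn U₂ (Set.Ioi 0))
    (hU₂_conc : StrictConcaveOn ℝ (Set.Ioi 0) U₂)
    (hU₂_deriv : ∀ x ∈ Set.Ioi (0:ℝ), HasDerivAt U₂ (U₂' x) x)
    (hU₂'_cont : ContinuousOn U₂' (Set.Ioi 0))
    (hU₂'_top : Filter.Tendsto U₂' Filter.atTop (nhds 0))
    (hU₂'_zero : Filter.Tendsto U₂' (nhdsWithin 0 (Set.Ioi 0)) Filter.atTop)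
    (hI₁ : ∀ t ∈ Set.Icc (0:ℝ) T, ∀ y ∈ Set.Ioi (0:ℝ),
      0 < I₁ t y ∧ U₁' t (I₁ t y) = y)
    (hI₁_cont : ContinuousOn (fun p : ℝ × ℝ => I₁ p.1 p.2) (Set.Icc 0 T ×ˢ Set.Ioi 0))
    (hI₂ : ∀ y ∈ Set.Ioi (0:ℝ), 0 < I₂ y ∧ U₂' (I₂ y) = y)
    (y s : ℝ) (hy : 0 < y) (hs : s ∈ Set.Icc (0:ℝ) T)
    {Ω : Type*} [MeasurableSpace Ω] (P : MeasureTheory.Measure Ω)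
    [MeasureTheory.IsProbabilityMeasure P]
    (ξ : Ω → ℝ) (hξ_meas : Measurable ξ) (hξ_pos : ∀ ω, 0 < ξ ω)
    (C : ℝ → Ω → ℝ) (hC_meas : Measurable (fun p : ℝ × Ω => C p.1 p.2))
    (hC_pos : ∀ t ∈ Set.Icc s T, ∀ ω, 0 < C t ω)
    (hC_int : ∀ ω, MeasureTheory.IntegrableOn (fun t => C t ω) (Set.Icc s T))
    (hbudget_int : MeasureTheory.Integrable
      (fun ω => ξ ω + ∫ t in s..T, C t ω) P)
    (hbudget : (∫ ω, (ξ ω + ∫ t in s..T, C t ω) ∂P) ≤ I₂ y + ∫ t in s..T, I₁ t y)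
    (hU₁neg_int : MeasureTheory.Integrable
      (fun p : ℝ × Ω => max (-(U₁ p.1 (C p.1 p.2))) 0)
      ((MeasureTheory.volume.restrict (Set.Icc s T)).prod P))
    (hU₂neg_int : MeasureTheory.Integrable (fun ω => max (-(U₂ (ξ ω))) 0) P) :
    (∫ ω, ((∫ t in s..T, U₁ t (C t ω)) + U₂ (ξ ω)) ∂P) ≤
      (∫ t in s..T, U₁ t (I₁ t y)) + U₂ (I₂ y) ∧
    (∫ ω, ((∫ t in s..T, U₁ t (I₁ t y)) + U₂ (I₂ y)) ∂P) =
      (∫ t in s..T, U₁ t (I₁ t y)) + U₂ (I₂ y) ∧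
    (∫ _ω, (I₂ y + ∫ t in s..T, I₁ t y) ∂P) = I₂ y + ∫ t in s..T, I₁ t y := by
  refine ⟨?_, by simp, by simp⟩
  have hsT : s ≤ T := hs.2
  have hsub : Icc s T ⊆ Icc 0 T := Icc_subset_Icc_left hs.1
  have hIcc (f : ℝ → ℝ) : ∫ t in s..T, f t = ∫ t in Icc s T, f t := by
    rw [integral_of_le hsT, integral_Icc_eq_integral_Ioc]
  simp only [hIcc] at hbudget_int hbudget ⊢
  set μ : Measure ℝ := volume.restrict (Icc s T) with hμ
  have hmemμ : ∀ᵐ t ∂μ, t ∈ Icc s T := ae_restrict_mem measurableSet_Icc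
  have hmem : ∀ᵐ p ∂(μ.prod P), p.1 ∈ Icc s T := Measure.quasiMeasurePreserving_fst.ae hmemμ
  -- the budget splits into its integrable parts
  have hC_nonneg (ω : Ω) : 0 ≤ ∫ t, C t ω ∂μ :=
    setIntegral_nonneg measurableSet_Icc fun t ht => (hC_pos t ht ω).le
  have hξ_int : Integrable ξ P := by
    refine hbudget_int.mono' hξ_meas.aestronglyMeasurable (ae_of_all _ fun ω => ?_)
    rw [Real.norm_of_nonneg (hξ_pos ω).le]
    linarith [hC_nonneg ω]
  have hCt_int : Integrable (fun ω => ∫ t, C t ω ∂μ) P :=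
    (hbudget_int.sub hξ_int).congr (ae_of_all _ fun ω => by simp)
  have hC_prod : Integrable (fun p : ℝ × Ω => C p.1 p.2) (μ.prod P) := by
    refine (integrable_prod_iff' hC_meas.aestronglyMeasurable).2
      ⟨ae_of_all _ hC_int, hCt_int.congr (ae_of_all _ fun ω => ?_)⟩
    refine integral_congr_ae ?_
    filter_upwards [hmemμ] with t ht
    exact (Real.norm_of_nonneg (hC_pos t ht ω).le).symm
  -- the optimal consumption rate and its utility
  have hI₁y : ContinuousOn (fun t => I₁ t y) (Icc s T) :=
    hI₁_cont.comp (f := fun t => (t, y)) (by fun_prop) fun t ht => ⟨hsub ht, hy⟩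
  have hU₁I₁ : ContinuousOn (fun t => U₁ t (I₁ t y)) (Icc s T) :=
    hU₁_cont.comp (f := fun t => (t, I₁ t y)) (continuousOn_id.prodMk hI₁y)
      fun t ht => ⟨hsub ht, (hI₁ t (hsub ht) y hy).1⟩
  have hI₁_int : Integrable (fun t => I₁ t y) μ := hI₁y.integrableOn_Icc
  have hU₁I₁_int : Integrable (fun t => U₁ t (I₁ t y)) μ := hU₁I₁.integrableOn_Icc
  have hexcess_int : Integrable (fun p : ℝ × Ω => y * (C p.1 p.2 - I₁ p.1 y)) (μ.prod P) :=
    (hC_prod.sub (hI₁_int.comp_fst P)).const_mul y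
  have hbound_int : Integrable
      (fun p : ℝ × Ω => U₁ p.1 (I₁ p.1 y) + y * (C p.1 p.2 - I₁ p.1 y)) (μ.prod P) :=
    (hU₁I₁_int.comp_fst P).add hexcess_int
  have hbound : ∀ᵐ p ∂(μ.prod P),
      U₁ p.1 (C p.1 p.2) ≤ U₁ p.1 (I₁ p.1 y) + y * (C p.1 p.2 - I₁ p.1 y) := by
    filter_upwards [hmem] with p hp
    obtain ⟨hpos, hinv⟩ := hI₁ p.1 (hsub hp) y hy
    have hd := hU₁_deriv p.1 (hsub hp) _ hpos
    rw [hinv] at hd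
    exact (hU₁_conc p.1 (hsub hp)).concaveOn.le_tangent hpos (hC_pos p.1 hp p.2) hd
  have hU₁_int : Integrable (fun p : ℝ × Ω => U₁ p.1 (C p.1 p.2)) (μ.prod P) := by
    refine integrable_of_negPart_of_le ?_ hU₁neg_int hbound_int hbound
    refine hU₁_cont.aestronglyMeasurable_comp (g := fun p : ℝ × Ω => (p.1, C p.1 p.2))
      (measurableSet_Icc.prod measurableSet_Ioi) (measurable_fst.prodMk hC_meas).aemeasurable ?_
    filter_upwards [hmem] with p hp
    exact ⟨hsub hp, hC_pos p.1 hp p.2⟩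
  have hconsumption : ∫ ω, ∫ t, U₁ t (C t ω) ∂μ ∂P ≤
      (∫ t, U₁ t (I₁ t y) ∂μ) + y * ((∫ ω, ∫ t, C t ω ∂μ ∂P) - ∫ t, I₁ t y ∂μ) := by
    have h := integral_mono_ae hU₁_int hbound_int hbound
    rw [integral_prod_symm _ hU₁_int,
      MeasureTheory.integral_add (hU₁I₁_int.comp_fst P) hexcess_int,
      MeasureTheory.integral_const_mul, MeasureTheory.integral_sub hC_prod (hI₁_int.comp_fst P),
      integral_prod_symm _ hC_prod, integral_fun_fst (fun t => U₁ t (I₁ t y)),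
      integral_fun_fst (fun t => I₁ t y)] at h
    simpa using h
  -- terminal wealth
  obtain ⟨hpos₂, hinv₂⟩ := hI₂ y hy
  have hbound₂ (ω : Ω) : U₂ (ξ ω) ≤ U₂ (I₂ y) + y * (ξ ω - I₂ y) := by
    have hd := hU₂_deriv _ hpos₂
    rw [hinv₂] at hd
    exact hU₂_conc.concaveOn.le_tangent hpos₂ (hξ_pos ω) hd
  have hξ_sub_int : Integrable (fun ω => y * (ξ ω - I₂ y)) P :=
    (hξ_int.sub (integrable_const _)).const_mul y
  have hbound₂_int : Integrable (fun ω => U₂ (I₂ y) + y * (ξ ω - I₂ y)) P :=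
    (integrable_const _).add hξ_sub_int
  have hU₂_int : Integrable (fun ω => U₂ (ξ ω)) P := by
    refine integrable_of_negPart_of_le ?_ hU₂neg_int hbound₂_int (ae_of_all _ hbound₂)
    exact ContinuousOn.aestronglyMeasurable_comp
      (fun x hx => (hU₂_deriv x hx).continuousAt.continuousWithinAt)
      measurableSet_Ioi hξ_meas.aemeasurable (ae_of_all _ hξ_pos)
  have hwealth : ∫ ω, U₂ (ξ ω) ∂P ≤ U₂ (I₂ y) + y * ((∫ ω, ξ ω ∂P) - I₂ y) := by
    have h := integral_mono hU₂_int hbound₂_int hbound₂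
    rw [MeasureTheory.integral_add (integrable_const _) hξ_sub_int, MeasureTheory.integral_const_mul,
      MeasureTheory.integral_sub hξ_int (integrable_const _)] at h
    simpa using h
  rw [MeasureTheory.integral_add hξ_int hCt_int] at hbudget
  rw [MeasureTheory.integral_add hU₁_int.integral_prod_right hU₂_int]
  nlinarith [mul_le_mul_of_nonneg_left hbudget hy.le]
end
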